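/- arXiv:2507.11850 — 2 statements merged into one kernel-verified Lean document; each statement's English description precedes it below -/
import Mathlib

section
/- Under the flotation setup, suppose there exist z ∈ ℝ² and λ > 0 such that r₂(s) = z + λ·(r₁(s) − z) for all s (the flotation curve is homothetic to the buoyancy curve). Then for every s, det(c(s), γ'(s))³ · det(γ'(t(s)), γ''(t(s))) + det(c(s), γ'(t(s)))³ · det(γ'(s), γ''(s)) = 0; equivalently, sin³α/κ(γ(s)) = sin³β/κ(γ(t(s))), where α and β are the angles between the chord of flotation and the tangent lines at its two endpoints and κ denotes the curvature of the boundary of K. -/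
open Real MeasureTheory intervalIntegral

noncomputable section

/-- The Euclidean plane. -/
abbrev R2 := EuclideanSpace ℝ (Fin 2)

/-- The planar determinant `det(u,v) = u₁v₂ − u₂v₁`. -/
def det2 (u v : R2) : ℝ := u 0 * v 1 - u 1 * v 0

/-- The flotation curve `r₁(s) = (γ(s) + γ(t(s)))/2`. -/
def flotCurve (γ : ℝ → R2) (t : ℝ → ℝ) (s : ℝ) : R2 := ((1:ℝ)/2) • (γ s + γ (t s))

/-- The buoyancy (centroid) curve
`r₂(s) = γ(s) + (1/(3δ))·∫_s^{t(s)} det(γ(u) − γ(s), γ'(u))·(γ(u) − γ(s)) du`. -/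
def buoyCurve (γ : ℝ → R2) (t : ℝ → ℝ) (δ : ℝ) (s : ℝ) : R2 :=
  γ s + (1/(3*δ)) • ∫ u in s..t s, det2 (γ u - γ s) (deriv γ u) • (γ u - γ s)

/-- Leibniz rule for the integral of a fixed continuous function between moving endpoints. -/
lemma hasDerivAt_integral_moving {f : ℝ → ℝ} (hf : Continuous f) {t : ℝ → ℝ} {t' s : ℝ}
    (ht : HasDerivAt t t' s) :
    HasDerivAt (fun s => ∫ u in s..t s, f u) (f (t s) * t' - f s) s := by
  have h0 (v : ℝ) : HasDerivAt (fun v => ∫ u in (0:ℝ)..v, f u) (f v) v :=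
    hf.integral_hasStrictDerivAt 0 v |>.hasDerivAt
  refine (((h0 (t s)).comp s ht).sub (h0 s)).congr_of_eventuallyEq (.of_forall fun v => ?_)
  exact (integral_interval_sub_left (hf.intervalIntegrable _ _) (hf.intervalIntegrable _ _)).symm

/-- The area swept from a moving base point, in terms of the area swept from the origin. -/
lemma integral_area_translate {X Y X' Y' : ℝ → ℝ} (hX : ∀ s, HasDerivAt X (X' s) s)
    (hY : ∀ s, HasDerivAt Y (Y' s) s) (hX' : Continuous X') (hY' : Continuous Y') (a b : ℝ) :
    ∫ u in a..b, ((X u - X a) * Y' u - (Y u - Y a) * X' u) =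
      (∫ u in a..b, (X u * Y' u - Y u * X' u)) - (X a * Y b - Y a * X b) := by
  have cX : Continuous X := continuous_iff_continuousAt.2 fun s => (hX s).continuousAt
  have cY : Continuous Y := continuous_iff_continuousAt.2 fun s => (hY s).continuousAt
  have key : ∫ u in a..b, (Y a * X' u - X a * Y' u) =
      (Y a * X b - X a * Y b) - (Y a * X a - X a * Y a) :=
    intervalIntegral.integral_eq_sub_of_hasDerivAt (fun u _ => ((hX u).const_mul (Y a)).sub ((hY u).const_mul (X a)))
      ((by fun_prop : Continuous fun u => Y a * X' u - X a * Y' u).intervalIntegrable _ _)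
  have hsum := intervalIntegral.integral_add (μ := volume)
    ((by fun_prop : Continuous fun u => X u * Y' u - Y u * X' u).intervalIntegrable a b)
    ((by fun_prop : Continuous fun u => Y a * X' u - X a * Y' u).intervalIntegrable a b)
  rw [key] at hsum
  rw [show (fun u => (X u - X a) * Y' u - (Y u - Y a) * X' u) =
    fun u => (X u * Y' u - Y u * X' u) + (Y a * X' u - X a * Y' u) by ext u; ring, hsum]
  ring

/-- The first moment of the area swept from a moving base point. -/
lemma integral_moment_translate {X Y X' Y' : ℝ → ℝ} (hX : ∀ s, HasDerivAt X (X' s) s)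
    (hY : ∀ s, HasDerivAt Y (Y' s) s) (hX' : Continuous X') (hY' : Continuous Y') (a b : ℝ) :
    ∫ u in a..b, ((X u - X a) * Y' u - (Y u - Y a) * X' u) * (X u - X a) =
      (∫ u in a..b, (X u * Y' u - Y u * X' u) * X u)
        - 3 / 2 * X a * (∫ u in a..b, (X u * Y' u - Y u * X' u))
        + (X a ^ 2 * (Y b - Y a) + Y a * (X b ^ 2 - X a ^ 2) / 2 - X a * Y a * (X b - X a)
          - X a * (X b * Y b - X a * Y a) / 2) := by
  have cX : Continuous X := continuous_iff_continuousAt.2 fun s => (hX s).continuousAt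
  have cY : Continuous Y := continuous_iff_continuousAt.2 fun s => (hY s).continuousAt
  let R : ℝ → ℝ := fun u => X a ^ 2 * Y' u + Y a * (X' u * X u + X u * X' u) / 2
    - X a * Y a * X' u - X a * (X' u * Y u + X u * Y' u) / 2
  have cR : Continuous R := by fun_prop
  have key : ∫ u in a..b, R u = _ - _ :=
    intervalIntegral.integral_eq_sub_of_hasDerivAt (fun u _ =>
      ((((hY u).const_mul (X a ^ 2)).add ((((hX u).mul (hX u)).const_mul (Y a)).div_const 2)).sub
        ((hX u).const_mul (X a * Y a))).sub ((((hX u).mul (hY u)).const_mul (X a)).div_const 2))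
      (cR.intervalIntegrable _ _)
  have i1 := (by fun_prop : Continuous fun u => (X u * Y' u - Y u * X' u) * X u).intervalIntegrable
    (μ := volume) a b
  have i2 := (by fun_prop : Continuous fun u =>
    3 / 2 * X a * (X u * Y' u - Y u * X' u)).intervalIntegrable (μ := volume) a b
  have hsum := intervalIntegral.integral_add (i1.sub i2) (cR.intervalIntegrable a b)
  rw [integral_sub i1 i2, key, intervalIntegral.integral_const_mul] at hsum
  rw [show (fun u => ((X u - X a) * Y' u - (Y u - Y a) * X' u) * (X u - X a)) =
    fun u => ((X u * Y' u - Y u * X' u) * X u - 3 / 2 * X a * (X u * Y' u - Y u * X' u)) + R u by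
      ext u; simp only [R]; ring, hsum]
  simp only [Pi.add_apply, Pi.sub_apply, Pi.mul_apply]
  ring

/-- If chords cut off constant area, the derivative of the other endpoint is governed by the
angles at the endpoints. -/
lemma deriv_endpoint_of_area_const {X Y X' Y' t : ℝ → ℝ} {t' s δ : ℝ}
    (hX : ∀ s, HasDerivAt X (X' s) s) (hY : ∀ s, HasDerivAt Y (Y' s) s)
    (hX' : Continuous X') (hY' : Continuous Y') (ht : HasDerivAt t t' s)
    (hA : ∀ s, ∫ u in s..t s, ((X u - X s) * Y' u - (Y u - Y s) * X' u) = 2 * δ) :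
    t' * ((X (t s) - X s) * Y' (t s) - (Y (t s) - Y s) * X' (t s)) +
      ((X (t s) - X s) * Y' s - (Y (t s) - Y s) * X' s) = 0 := by
  have cX : Continuous X := continuous_iff_continuousAt.2 fun s => (hX s).continuousAt
  have cY : Continuous Y := continuous_iff_continuousAt.2 fun s => (hY s).continuousAt
  have h1 := (hasDerivAt_integral_moving
    (by fun_prop : Continuous fun u => X u * Y' u - Y u * X' u) ht).sub
    (((hX s).mul ((hY (t s)).comp s ht)).sub ((hY s).mul ((hX (t s)).comp s ht)))
  have h2 := h1.congr_of_eventuallyEq (f₁ := fun _ => 2 * δ) (.of_forall fun v => by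
    simp only [Pi.sub_apply, Pi.mul_apply, Function.comp_apply]
    rw [← hA v, integral_area_translate hX hY hX' hY'])
  have h3 := h2.unique (hasDerivAt_const s (2 * δ))
  simp only [Function.comp_apply] at h3
  linear_combination h3

/-- The centroid of the cut-off region moves parallel to the chord. -/
lemma hasDerivAt_centroid {X Y X' Y' t : ℝ → ℝ} {t' s δ : ℝ} (hδ : δ ≠ 0)
    (hX : ∀ s, HasDerivAt X (X' s) s) (hY : ∀ s, HasDerivAt Y (Y' s) s)
    (hX' : Continuous X') (hY' : Continuous Y') (ht : HasDerivAt t t' s)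
    (hA : ∀ s, ∫ u in s..t s, ((X u - X s) * Y' u - (Y u - Y s) * X' u) = 2 * δ) :
    HasDerivAt (fun s => X s + 1 / (3 * δ) *
        ∫ u in s..t s, ((X u - X s) * Y' u - (Y u - Y s) * X' u) * (X u - X s))
      (-(1 / (6 * δ)) * ((X (t s) - X s) * Y' s - (Y (t s) - Y s) * X' s) * (X (t s) - X s)) s := by
  have cX : Continuous X := continuous_iff_continuousAt.2 fun s => (hX s).continuousAt
  have cY : Continuous Y := continuous_iff_continuousAt.2 fun s => (hY s).continuousAt
  have hI := hasDerivAt_integral_moving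
    (by fun_prop : Continuous fun u => (X u * Y' u - Y u * X' u) * X u) ht
  have hx := hX s
  have hy := hY s
  have hxt : HasDerivAt (fun s => X (t s)) (X' (t s) * t') s := (hX (t s)).comp s ht
  have hyt : HasDerivAt (fun s => Y (t s)) (Y' (t s) * t') s := (hY (t s)).comp s ht
  have hp := deriv_endpoint_of_area_const hX hY hX' hY' ht hA
  have hP := ((((hx.mul hx).mul hyt).mul_const (-1 / 2)).add
    ((((hx.mul hxt).mul hy).mul_const (1 / 2)).add ((hy.mul (hxt.mul hxt)).mul_const (1 / 2)))).sub
    ((hx.mul (hxt.mul hyt)).mul_const (1 / 2))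
  have hD := (hI.add hP).const_mul (1 / (3 * δ))
  refine (hD.congr_of_eventuallyEq (.of_forall fun v => ?_)).congr_deriv ?_
  · simp only [Pi.add_apply, Pi.sub_apply, Pi.mul_apply]
    have h1 := hA v
    rw [integral_area_translate hX hY hX' hY'] at h1
    rw [integral_moment_translate hX hY hX' hY']
    field_simp
    linear_combination (-3 * X v) * h1
  · simp only [Pi.mul_apply]
    field_simp
    linear_combination (12 * X (t s) + 6 * X s) * hp

/-- If the midpoint of the chord moves parallel to the chord with the given speed, the determinant
of the end tangents is proportional to the product of the chord-tangent determinants. -/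
lemma tangent_det_of_parallel {x y a b e f t' m : ℝ} (hp : x * b - y * a ≠ 0)
    (hE : t' * (x * f - y * e) + (x * b - y * a) = 0)
    (hx : -m * (x * b - y * a) * x = a + t' * e) (hy : -m * (x * b - y * a) * y = b + t' * f) :
    a * f - b * e = -m * (x * b - y * a) * (x * f - y * e) := by
  apply mul_left_cancel₀ hp
  linear_combination (-(x * f - y * e)) * (b * hx - a * hy) + (a * f - b * e) * hE

/-- Differentiated form of the tangent relation, as a cubic identity between the endpoints. -/
lemma cubic_relation {x y a b e f a' b' e' f' t' m : ℝ}
    (hE : t' * (x * f - y * e) + (x * b - y * a) = 0)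
    (hx : -m * (x * b - y * a) * x = a + t' * e) (hy : -m * (x * b - y * a) * y = b + t' * f)
    (hD : (a' * f + a * (f' * t')) - (b' * e + b * (e' * t')) =
      -m * ((((e * t' - a) * b + x * b') - ((f * t' - b) * a + y * a')) * (x * f - y * e) +
        (x * b - y * a) * (((e * t' - a) * f + x * (f' * t')) - ((f * t' - b) * e + y * (e' * t'))))) :
    (x * b - y * a) ^ 3 * (e * f' - f * e') + (x * f - y * e) ^ 3 * (a * b' - b * a') = 0 := by
  obtain ⟨p, hpd⟩ : ∃ p, p = x * b - y * a := ⟨_, rfl⟩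
  obtain ⟨q, hqd⟩ : ∃ q, q = x * f - y * e := ⟨_, rfl⟩
  rw [← hpd] at hE hx hy hD ⊢
  rw [← hqd] at hE hD ⊢
  have hx' : q * a - p * e = -m * p * q * x := by linear_combination (-q) * hx - e * hE
  have hy' : q * b - p * f = -m * p * q * y := by linear_combination (-q) * hy - f * hE
  have hD' : (a' * f - b' * e + m * q * (x * b' - y * a')) +
      t' * (a * f' - b * e' + m * p * (x * f' - y * e')) = 0 := by
    linear_combination hD + m * (a * f - b * e) * hE
  linear_combination -p * q ^ 2 * hD' + (q ^ 2 * b' - p ^ 2 * f') * hx' -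
    (q ^ 2 * a' - p ^ 2 * e') * hy' +
    p * q * (a * f' - b * e' + m * p * (x * f' - y * e')) * hE

/-- homothety of flotation and buoyancy curve implies
`sin³α/κ(γ(s)) = sin³β/κ(γ(t(s)))` for every chord of flotation. -/
theorem stmt10
    (γ : ℝ → R2) (L : ℝ) (hL : 0 < L)
    (hγ : ContDiff ℝ 2 γ)
    (hper : ∀ s, γ (s + L) = γ s)
    (hreg : ∀ s, deriv γ s ≠ 0)
    (hinj : Set.InjOn γ (Set.Ico 0 L))
    (hor : 0 < ∫ s in (0:ℝ)..L, det2 (γ s) (deriv γ s))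
    (K : Set R2) (hKconv : Convex ℝ K) (hKcomp : IsCompact K)
    (hKint : (interior K).Nonempty) (hKbd : frontier K = Set.range γ)
    (δ : ℝ) (hδ0 : 0 < δ) (hδK : δ < (volume K).toReal)
    (t : ℝ → ℝ) (ht : ContDiff ℝ 1 t)
    (htrange : ∀ s, s < t s ∧ t s < s + L)
    (hA : ∀ s, (1/2) * ∫ u in s..t s, det2 (γ u - γ s) (deriv γ u) = δ)
    (hc1 : ∀ s, det2 (γ (t s) - γ s) (deriv γ s) ≠ 0)
    (hc2 : ∀ s, det2 (γ (t s) - γ s) (deriv γ (t s)) ≠ 0)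
    (z : R2) (lam : ℝ) (hlam : 0 < lam)
    (hhom : ∀ s, buoyCurve γ t δ s = z + lam • (flotCurve γ t s - z)) :
    ∀ s : ℝ,
      det2 (γ (t s) - γ s) (deriv γ s) ^ 3 * det2 (deriv γ (t s)) (deriv (deriv γ) (t s)) +
        det2 (γ (t s) - γ s) (deriv γ (t s)) ^ 3 * det2 (deriv γ s) (deriv (deriv γ) s) = 0 := by
  have hγ1 : ContDiff ℝ 1 (deriv γ) := ((contDiff_succ_iff_deriv (n := 1)).1 hγ).2.2
  have hd (s : ℝ) : HasDerivAt γ (deriv γ s) s := (hγ.differentiable (by norm_num) s).hasDerivAt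
  have hdd (s : ℝ) : HasDerivAt (deriv γ) (deriv (deriv γ) s) s :=
    (hγ1.differentiable (by norm_num) s).hasDerivAt
  have hcoord {g : ℝ → R2} {g' : R2} {s : ℝ} (h : HasDerivAt g g' s) (i : Fin 2) :
      HasDerivAt (fun s => g s i) (g' i) s :=
    (EuclideanSpace.proj (𝕜 := ℝ) i).hasFDerivAt.comp_hasDerivAt s h
  have hcont (i : Fin 2) : Continuous fun s => deriv γ s i :=
    (EuclideanSpace.proj (𝕜 := ℝ) i).continuous.comp hγ1.continuous
  have htd (s : ℝ) : HasDerivAt t (deriv t s) s := (ht.differentiable (by norm_num) s).hasDerivAt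
  have hbuoy (i : Fin 2) (s : ℝ) : buoyCurve γ t δ s i = γ s i + 1 / (3 * δ) *
      ∫ u in s..t s, det2 (γ u - γ s) (deriv γ u) * (γ u i - γ s i) := by
    have hc : Continuous fun u => det2 (γ u - γ s) (deriv γ u) • (γ u - γ s) := by
      have h0 : Continuous fun u => γ u 0 :=
        (EuclideanSpace.proj (𝕜 := ℝ) (0 : Fin 2)).continuous.comp hγ.continuous
      have h1 : Continuous fun u => γ u 1 :=
        (EuclideanSpace.proj (𝕜 := ℝ) (1 : Fin 2)).continuous.comp hγ.continuous
      have h2 := hcont 0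
      have h3 := hcont 1
      have h4 := hγ.continuous
      simp only [det2, PiLp.sub_apply]
      fun_prop
    have := (EuclideanSpace.proj (𝕜 := ℝ) i).intervalIntegral_comp_comm
      (hc.intervalIntegrable (μ := volume) s (t s))
    simp only [PiLp.proj_apply, PiLp.smul_apply, PiLp.sub_apply, smul_eq_mul] at this
    simp only [buoyCurve, PiLp.add_apply, PiLp.smul_apply, smul_eq_mul, this]
  have hA' (s : ℝ) : ∫ u in s..t s, ((γ u 0 - γ s 0) * deriv γ u 1 -
      (γ u 1 - γ s 1) * deriv γ u 0) = 2 * δ := by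
    have := hA s
    simp only [det2, PiLp.sub_apply] at this
    linarith
  have hA'' (s : ℝ) : ∫ u in s..t s, ((γ u 1 - γ s 1) * deriv γ u 0 -
      (γ u 0 - γ s 0) * deriv γ u 1) = 2 * -δ := by
    rw [mul_neg, ← hA' s, ← intervalIntegral.integral_neg]
    congr 1 with u
    ring
  simp only [det2, PiLp.sub_apply] at hc1 hc2 ⊢
  have hE (s : ℝ) := deriv_endpoint_of_area_const (fun s => hcoord (hd s) 0)
    (fun s => hcoord (hd s) 1) (hcont 0) (hcont 1) (htd s) hA'
  have hflot (i : Fin 2) (s : ℝ) : HasDerivAt (fun s => buoyCurve γ t δ s i)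
      (lam * (1 / 2 * (deriv γ s i + deriv γ (t s) i * deriv t s))) s := by
    have h := (((((hcoord (hd s) i).add ((hcoord (hd (t s)) i).comp s (htd s))).const_mul
      (1 / 2 : ℝ)).sub_const (z i)).const_mul lam).const_add (z i)
    refine h.congr_of_eventuallyEq (.of_forall fun v => ?_)
    simp [hhom v, flotCurve, -mul_eq_mul_left_iff]
    ring
  have hx (s : ℝ) : -(1 / (3 * δ * lam)) * ((γ (t s) 0 - γ s 0) * deriv γ s 1 -
      (γ (t s) 1 - γ s 1) * deriv γ s 0) * (γ (t s) 0 - γ s 0) =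
      deriv γ s 0 + deriv t s * deriv γ (t s) 0 := by
    have h := hasDerivAt_centroid hδ0.ne' (fun s => hcoord (hd s) 0)
      (fun s => hcoord (hd s) 1) (hcont 0) (hcont 1) (htd s) hA'
    have h' := h.unique ((hflot 0 s).congr_of_eventuallyEq (.of_forall fun v => by
      simp only [hbuoy, det2, PiLp.sub_apply]))
    field_simp at h' ⊢
    linear_combination h' / 2
  have hy (s : ℝ) : -(1 / (3 * δ * lam)) * ((γ (t s) 0 - γ s 0) * deriv γ s 1 -
      (γ (t s) 1 - γ s 1) * deriv γ s 0) * (γ (t s) 1 - γ s 1) =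
      deriv γ s 1 + deriv t s * deriv γ (t s) 1 := by
    have h := hasDerivAt_centroid (neg_ne_zero.2 hδ0.ne') (fun s => hcoord (hd s) 1)
      (fun s => hcoord (hd s) 0) (hcont 1) (hcont 0) (htd s) hA''
    have h' := h.unique ((hflot 1 s).congr_of_eventuallyEq (.of_forall fun v => by
      simp only [hbuoy, det2, PiLp.sub_apply]
      rw [mul_neg, one_div_neg_eq_neg_one_div, neg_mul, ← mul_neg,
        ← intervalIntegral.integral_neg]
      congr 3 with u
      ring))
    field_simp at h' ⊢
    linear_combination h' / 2
  have hD (s : ℝ) := tangent_det_of_parallel (hc1 s) (hE s) (hx s) (hy s)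
  intro s
  have d (i : Fin 2) := hcoord (hdd s) i
  have dt (i : Fin 2) : HasDerivAt (fun s => deriv γ (t s) i)
    (deriv (deriv γ) (t s) i * deriv t s) s := (hcoord (hdd (t s)) i).comp s (htd s)
  have dc (i : Fin 2) : HasDerivAt (fun s => γ (t s) i - γ s i)
    (deriv γ (t s) i * deriv t s - deriv γ s i) s :=
    ((hcoord (hd (t s)) i).comp s (htd s)).sub (hcoord (hd s) i)
  have hl := ((d 0).mul (dt 1)).sub ((d 1).mul (dt 0))
  have hr := ((((dc 0).mul (d 1)).sub ((dc 1).mul (d 0))).mul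
    (((dc 0).mul (dt 1)).sub ((dc 1).mul (dt 0)))).const_mul (-(1 / (3 * δ * lam)))
  have hlr := hl.unique (hr.congr_of_eventuallyEq (.of_forall fun v => by
    simp only [Pi.sub_apply, Pi.mul_apply]
    rw [hD v]
    ring))
  exact cubic_relation (hE s) (hx s) (hy s) hlr
end
end

section
/- Under the flotation setup, the following integral identity holds: (1/2)·∫₀^L det(γ(s), γ'(s)) ds − (1/2)·∫₀^L det(r₁(s), r₁'(s)) ds = (1/2)·((3/2)·δ)^{2/3} · ∫₀^L (12δ / |c(s)|³)^{1/3} · |r₂'(s)| ds. In words: the area of K minus the area enclosed by the flotation curve equals one half of đ^{2/3} times the affine arc length Ω(Γ_δ(K)) of the buoyancy curve, where đ = (3/2)·δ and the affine arc length is the integral of the cube root of the curvature with respect to Euclidean arc length. -/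
open Real MeasureTheory intervalIntegral

noncomputable section

/-- The doubled area cut off by a chord in terms of a primitive `P` of `x * y'`. -/
lemma integral_chord_area {x y x' y' P : ℝ → ℝ} (hx : ∀ u, HasDerivAt x (x' u) u)
    (hy : ∀ u, HasDerivAt y (y' u) u) (cx' : Continuous x') (cy' : Continuous y')
    (hP : ∀ u, HasDerivAt P (x u * y' u) u) (s τ : ℝ) :
    ∫ u in s..τ, ((x u - x s) * y' u - (y u - y s) * x' u) =
      2 * (P τ - P s) - 2 * x s * (y τ - y s) - (x τ - x s) * (y τ - y s) := by
  have cx : Continuous x := continuous_iff_continuousAt.2 fun u => (hx u).continuousAt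
  have cy : Continuous y := continuous_iff_continuousAt.2 fun u => (hy u).continuousAt
  rw [integral_eq_sub_of_hasDerivAt
    (f := fun u => 2 * P u - 2 * x s * y u - (x u - x s) * (y u - y s))]
  · ring
  · intro u _
    refine ((((hP u).const_mul 2).sub ((hy u).const_mul (2 * x s))).sub
      (((hx u).sub_const _).mul ((hy u).sub_const _))).congr_deriv ?_
    ring
  · exact Continuous.intervalIntegrable (by fun_prop) _ _

/-- Derivative of the doubled area cut off by a moving chord from a plane curve `(x, y)`. -/
lemma hasDerivAt_chord_area {x y x' y' t : ℝ → ℝ} (hx : ∀ u, HasDerivAt x (x' u) u)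
    (hy : ∀ u, HasDerivAt y (y' u) u) (cx' : Continuous x') (cy' : Continuous y')
    {s t' : ℝ} (ht : HasDerivAt t t' s) :
    HasDerivAt (fun s => ∫ u in s..t s, ((x u - x s) * y' u - (y u - y s) * x' u))
      (((x (t s) - x s) * y' (t s) - (y (t s) - y s) * x' (t s)) * t' +
        ((x (t s) - x s) * y' s - (y (t s) - y s) * x' s)) s := by
  have cx : Continuous x := continuous_iff_continuousAt.2 fun u => (hx u).continuousAt
  have hP (u : ℝ) : HasDerivAt (fun τ => ∫ v in (0 : ℝ)..τ, x v * y' v) (x u * y' u) u :=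
    (cx.mul cy').integral_hasStrictDerivAt 0 u |>.hasDerivAt
  set P := fun τ => ∫ v in (0 : ℝ)..τ, x v * y' v
  have key : (fun s => ∫ u in s..t s, ((x u - x s) * y' u - (y u - y s) * x' u)) =
      fun s => 2 * (P (t s) - P s) - 2 * x s * (y (t s) - y s)
        - (x (t s) - x s) * (y (t s) - y s) := by
    funext s
    exact integral_chord_area hx hy cx' cy' hP s (t s)
  rw [key]
  have hxt := (hx (t s)).comp s ht
  have hyt := (hy (t s)).comp s ht
  refine ((((((hP (t s)).comp s ht).sub (hP s)).const_mul 2).sub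
    (((hx s).const_mul 2).mul (hyt.sub (hy s)))).sub
    ((hxt.sub (hx s)).mul (hyt.sub (hy s)))).congr_deriv ?_
  simp only [Pi.sub_apply, Function.comp_apply]
  ring

/-- Derivative of the first coordinate of the moment cut off by a moving chord from a plane
curve `(x, y)`. -/
lemma hasDerivAt_chord_moment {x y x' y' t : ℝ → ℝ} (hx : ∀ u, HasDerivAt x (x' u) u)
    (hy : ∀ u, HasDerivAt y (y' u) u) (cx' : Continuous x') (cy' : Continuous y')
    {s t' : ℝ} (ht : HasDerivAt t t' s) :
    HasDerivAt
      (fun s => ∫ u in s..t s, ((x u - x s) * y' u - (y u - y s) * x' u) * (x u - x s))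
      ((x (t s) - x s) * ((x (t s) - x s) * y' (t s) - (y (t s) - y s) * x' (t s)) * t' +
        (x (t s) - x s) * ((x (t s) - x s) * y' s - (y (t s) - y s) * x' s) / 2 -
        3 / 2 * (∫ u in s..t s, ((x u - x s) * y' u - (y u - y s) * x' u)) * x' s) s := by
  have cx : Continuous x := continuous_iff_continuousAt.2 fun u => (hx u).continuousAt
  have cy : Continuous y := continuous_iff_continuousAt.2 fun u => (hy u).continuousAt
  have hP (u : ℝ) : HasDerivAt (fun τ => ∫ v in (0 : ℝ)..τ, x v * y' v) (x u * y' u) u :=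
    (cx.mul cy').integral_hasStrictDerivAt 0 u |>.hasDerivAt
  have hQ (u : ℝ) : HasDerivAt (fun τ => ∫ v in (0 : ℝ)..τ, x v ^ 2 * y' v) (x u ^ 2 * y' u) u :=
    ((cx.pow 2).mul cy').integral_hasStrictDerivAt 0 u |>.hasDerivAt
  set P := fun τ => ∫ v in (0 : ℝ)..τ, x v * y' v
  set Q := fun τ => ∫ v in (0 : ℝ)..τ, x v ^ 2 * y' v
  have key : (fun s => ∫ u in s..t s,
        ((x u - x s) * y' u - (y u - y s) * x' u) * (x u - x s)) =
      fun s => 3 / 2 * ((Q (t s) - Q s) - 2 * (x s * (P (t s) - P s))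
        + x s ^ 2 * (y (t s) - y s)) - 1 / 2 * ((y (t s) - y s) * (x (t s) - x s) ^ 2) := by
    funext s
    rw [integral_eq_sub_of_hasDerivAt
      (f := fun u => 3 / 2 * (Q u - 2 * x s * P u + x s ^ 2 * y u)
        - 1 / 2 * ((y u - y s) * (x u - x s) ^ 2))]
    · ring
    · intro u _
      refine (((((hQ u).sub ((hP u).const_mul (2 * x s))).add
        ((hy u).const_mul (x s ^ 2))).const_mul (3 / 2)).sub
        ((((hy u).sub_const _).mul (((hx u).sub_const _).pow 2)).const_mul (1 / 2))).congr_deriv ?_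
      simp only [Nat.cast_ofNat, Pi.pow_apply]
      ring
    · exact Continuous.intervalIntegrable (by fun_prop) _ _
  rw [key, integral_chord_area hx hy cx' cy' hP]
  have hxt := (hx (t s)).comp s ht
  have hyt := (hy (t s)).comp s ht
  refine (((((((hQ (t s)).comp s ht).sub (hQ s)).sub
    (((hx s).mul (((hP (t s)).comp s ht).sub (hP s))).const_mul 2)).add
    (((hx s).pow 2).mul (hyt.sub (hy s)))).const_mul (3 / 2)).sub
    (((hyt.sub (hy s)).mul ((hxt.sub (hx s)).pow 2)).const_mul (1 / 2))).congr_deriv ?_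
  simp only [Pi.sub_apply, Pi.pow_apply, Function.comp_apply, Nat.cast_ofNat]
  ring

lemma linear_map_R2_apply (f : R2 →L[ℝ] ℝ) (v : R2) :
    f v = v 0 * f (EuclideanSpace.single 0 1) + v 1 * f (EuclideanSpace.single 1 1) := by
  have h : v = v 0 • EuclideanSpace.single 0 (1 : ℝ) + v 1 • EuclideanSpace.single 1 (1 : ℝ) := by
    ext i
    fin_cases i <;> simp
  conv_lhs => rw [h]
  simp

/-- The tangent line at a regular point of a curve bounding a convex body does not meet the
interior of the body, and the body lies on one side of it. -/
lemma tangent_supports {K : Set R2} (hK : Convex ℝ K) (hKint : (interior K).Nonempty)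
    {γ : ℝ → R2} (hKbd : frontier K = Set.range γ) (hγK : ∀ u, γ u ∈ K) {τ : ℝ} {v : R2}
    (hγ : HasDerivAt γ v τ) (hv : v ≠ 0) {p x : R2} (hp : p ∈ interior K) (hx : x ∈ K) :
    det2 (γ τ - p) v ≠ 0 ∧ 0 ≤ det2 (γ τ - x) v * det2 (γ τ - p) v := by
  have hτ : γ τ ∉ interior K := by
    have : γ τ ∈ frontier K := hKbd ▸ Set.mem_range_self τ
    exact this.2
  obtain ⟨f, hf⟩ := geometric_hahn_banach_open_point hK.interior isOpen_interior hτ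
  have hle : ∀ y ∈ K, f y ≤ f (γ τ) := by
    intro y hy
    have hy' : y ∈ closure (interior K) := by
      rw [hK.closure_interior_eq_closure_of_nonempty_interior hKint]
      exact subset_closure hy
    exact closure_minimal (fun a ha => (hf a ha).le)
      (isClosed_le f.continuous continuous_const) hy'
  have hfv : f v = 0 := by
    have hmax : IsLocalMax (fun u => f (γ u)) τ :=
      Filter.Eventually.of_forall fun u => hle _ (hγK u)
    exact hmax.hasDerivAt_eq_zero (f.hasFDerivAt.comp_hasDerivAt τ hγ)
  have hpos : 0 < v 0 ^ 2 + v 1 ^ 2 := by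
    by_contra h
    refine hv ?_
    ext i
    fin_cases i
    · simp; nlinarith [sq_nonneg (v 0), sq_nonneg (v 1)]
    · simp; nlinarith [sq_nonneg (v 0), sq_nonneg (v 1)]
  set a := f (EuclideanSpace.single 0 1)
  set b := f (EuclideanSpace.single 1 1)
  have hab : v 0 * a + v 1 * b = 0 := by rw [← linear_map_R2_apply, hfv]
  have key (w : R2) : (v 0 ^ 2 + v 1 ^ 2) * f w = (a * v 1 - b * v 0) * det2 w v := by
    rw [linear_map_R2_apply f w, det2]
    linear_combination (v 0 * w 0 + v 1 * w 1) * hab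
  have h1 : 0 < (a * v 1 - b * v 0) * det2 (γ τ - p) v := by
    rw [← key, map_sub]
    exact mul_pos hpos (sub_pos.2 (hf p hp))
  have h2 : 0 ≤ (a * v 1 - b * v 0) * det2 (γ τ - x) v := by
    rw [← key, map_sub]
    exact mul_nonneg hpos.le (sub_nonneg.2 (hle x hx))
  refine ⟨fun h => by simp [h] at h1, ?_⟩
  by_contra! h
  have hc : 0 < (a * v 1 - b * v 0) ^ 2 := by
    refine sq_pos_of_ne_zero fun h0 => ?_
    simp [h0] at h1
  nlinarith [mul_pos_of_neg_of_neg h (neg_lt_zero.2 hc)]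

/-- For a positively oriented convex curve, the body lies to the left of each tangent line. -/
lemma det2_tangent_nonneg {K : Set R2} (hK : Convex ℝ K) (hKint : (interior K).Nonempty)
    {γ : ℝ → R2} (hKbd : frontier K = Set.range γ) (hγK : ∀ u, γ u ∈ K) {L : ℝ} (hL : 0 < L)
    (hγ : ContDiff ℝ 1 γ) (hper : ∀ s, γ (s + L) = γ s) (hreg : ∀ s, deriv γ s ≠ 0)
    (hor : 0 < ∫ s in (0:ℝ)..L, det2 (γ s) (deriv γ s)) (τ : ℝ) {x : R2} (hx : x ∈ K) :
    0 ≤ det2 (γ τ - x) (deriv γ τ) := by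
  obtain ⟨p, hp⟩ := hKint
  have hd (u : ℝ) : HasDerivAt γ (deriv γ u) u := (hγ.differentiable (by simp) u).hasDerivAt
  have hd' (i : Fin 2) (u : ℝ) : HasDerivAt (fun v => γ v i) (deriv γ u i) u :=
    (EuclideanSpace.proj (𝕜 := ℝ) i).hasFDerivAt.comp_hasDerivAt u (hd u)
  have hsup (u : ℝ) := tangent_supports hK ⟨p, hp⟩ hKbd hγK (hd u) (hreg u) hp hx
  have cγ : Continuous γ := hγ.continuous
  have cγ' : Continuous (deriv γ) := hγ.continuous_deriv (by simp)
  have cdet : Continuous fun u => det2 (γ u - p) (deriv γ u) := by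
    unfold det2
    fun_prop
  have hint : ∫ s in (0:ℝ)..L, det2 (γ s - p) (deriv γ s) =
      ∫ s in (0:ℝ)..L, det2 (γ s) (deriv γ s) := by
    rw [← sub_eq_zero, ← intervalIntegral.integral_sub (cdet.intervalIntegrable _ _)
      (Continuous.intervalIntegrable (by unfold det2; fun_prop) _ _),
      integral_eq_sub_of_hasDerivAt (f := fun u => p 1 * γ u 0 - p 0 * γ u 1)]
    · have h0 := hper 0
      rw [zero_add] at h0
      simp [h0]
    · intro u _
      refine (((hd' 0 u).const_mul (p 1)).sub ((hd' 1 u).const_mul (p 0))).congr_deriv ?_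
      simp only [det2, PiLp.sub_apply]
      ring
    · exact Continuous.intervalIntegrable (by unfold det2; fun_prop) _ _
  obtain ⟨u, hu⟩ : ∃ u, 0 < det2 (γ u - p) (deriv γ u) := by
    by_contra! h
    rw [← hint] at hor
    have := intervalIntegral.integral_nonneg (μ := volume) (f := fun s =>
      -det2 (γ s - p) (deriv γ s)) hL.le (fun s _ => neg_nonneg.2 (h s))
    rw [intervalIntegral.integral_neg] at this
    linarith
  have hτ : 0 < det2 (γ τ - p) (deriv γ τ) := by
    by_contra! h
    obtain ⟨w, hw⟩ := mem_range_of_exists_le_of_exists_ge cdet ⟨τ, h⟩ ⟨u, hu.le⟩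
    exact (hsup w).1 hw
  exact nonneg_of_mul_nonneg_left (hsup τ).2 hτ

/-- The end point of the chord of flotation is equivariant under the period. -/
lemma flotation_add_period {γ : ℝ → R2} {L : ℝ} {t : ℝ → ℝ} {δ : ℝ} (hγ : ContDiff ℝ 1 γ)
    (hper : ∀ s, γ (s + L) = γ s)
    (hA : ∀ s, (1/2) * ∫ u in s..t s, det2 (γ u - γ s) (deriv γ u) = δ)
    (hc : ∀ s, det2 (γ (t s) - γ s) (deriv γ (t s)) ≠ 0)
    (hnonneg : ∀ s u, 0 ≤ det2 (γ u - γ s) (deriv γ u)) (s : ℝ) :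
    t (s + L) = t s + L := by
  have cγ : Continuous γ := hγ.continuous
  have cγ' : Continuous (deriv γ) := hγ.continuous_deriv (by simp)
  have hperd (u : ℝ) : deriv γ (u + L) = deriv γ u := by
    rw [← deriv_comp_add_const, funext hper]
  set F := fun u => det2 (γ u - γ s) (deriv γ u) with hF
  have cF : Continuous F := by
    simp only [hF, det2]
    fun_prop
  have h1 : ∫ u in s..(t (s + L) - L), F u = ∫ u in s..t s, F u := by
    have h2 := intervalIntegral.integral_comp_add_right (a := s) (b := t (s + L) - L)
      (fun u => det2 (γ u - γ (s + L)) (deriv γ u)) L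
    simp only [hper, hperd, sub_add_cancel] at h2
    have h3 := hA (s + L)
    rw [hper] at h3
    simp only [hF]
    linarith [hA s]
  have h0 : ∫ u in (t s)..(t (s + L) - L), F u = 0 := by
    rw [← intervalIntegral.integral_interval_sub_left (cF.intervalIntegrable s _)
      (cF.intervalIntegrable s _), h1, sub_self]
  have hpos : 0 < F (t s) := lt_of_le_of_ne (hnonneg s _) (hc s).symm
  rcases lt_trichotomy (t s) (t (s + L) - L) with h | h | h
  · exact absurd h0 (intervalIntegral.integral_pos h cF.continuousOn
      (fun u _ => hnonneg s u) ⟨t s, ⟨le_rfl, h.le⟩, hpos⟩).ne'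
  · linarith
  · rw [intervalIntegral.integral_symm, neg_eq_zero] at h0
    exact absurd h0 (intervalIntegral.integral_pos h cF.continuousOn
      (fun u _ => hnonneg s u) ⟨t s, ⟨h.le, le_rfl⟩, hpos⟩).ne'

lemma hasDerivAt_coord {γ : ℝ → R2} {v : R2} {u : ℝ} (h : HasDerivAt γ v u) (i : Fin 2) :
    HasDerivAt (fun w => γ w i) (v i) u :=
  (EuclideanSpace.proj (𝕜 := ℝ) i).hasFDerivAt.comp_hasDerivAt u h

/-- The flotation curve moves along the chord of flotation. -/
lemma det2_chord_deriv {γ : ℝ → R2} {t : ℝ → ℝ} {δ : ℝ} (hγ : ContDiff ℝ 1 γ)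
    (ht : Differentiable ℝ t)
    (hA : ∀ s, (1/2) * ∫ u in s..t s, det2 (γ u - γ s) (deriv γ u) = δ) (s : ℝ) :
    det2 (γ (t s) - γ s) (deriv γ (t s)) * deriv t s +
      det2 (γ (t s) - γ s) (deriv γ s) = 0 := by
  have hd (u : ℝ) : HasDerivAt γ (deriv γ u) u := (hγ.differentiable (by simp) u).hasDerivAt
  have cγ' : Continuous (deriv γ) := hγ.continuous_deriv (by simp)
  have h := hasDerivAt_chord_area (fun u => hasDerivAt_coord (hd u) 0)
    (fun u => hasDerivAt_coord (hd u) 1) (by fun_prop) (by fun_prop) (ht s).hasDerivAt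
  have hconst : (fun s => ∫ u in s..t s, ((γ u 0 - γ s 0) * deriv γ u 1 -
      (γ u 1 - γ s 1) * deriv γ u 0)) = fun _ => 2 * δ := by
    funext s
    have := hA s
    simp only [det2, PiLp.sub_apply] at this
    linarith
  rw [hconst] at h
  simpa only [det2, PiLp.sub_apply] using h.unique (hasDerivAt_const s _)

/-- The buoyancy curve moves parallel to the chord of flotation. -/
lemma hasDerivAt_buoyCurve {γ : ℝ → R2} {t : ℝ → ℝ} {δ : ℝ} (hδ : δ ≠ 0) (hγ : ContDiff ℝ 1 γ)
    (ht : Differentiable ℝ t)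
    (hA : ∀ s, (1/2) * ∫ u in s..t s, det2 (γ u - γ s) (deriv γ u) = δ) (s : ℝ) :
    HasDerivAt (buoyCurve γ t δ)
      ((-det2 (γ (t s) - γ s) (deriv γ s) / (6 * δ)) • (γ (t s) - γ s)) s := by
  have hd (u : ℝ) : HasDerivAt γ (deriv γ u) u := (hγ.differentiable (by simp) u).hasDerivAt
  have cγ : Continuous γ := hγ.continuous
  have cγ' : Continuous (deriv γ) := hγ.continuous_deriv (by simp)
  have htan := det2_chord_deriv hγ ht hA s
  have hAs := hA s
  simp only [det2, PiLp.sub_apply] at htan hAs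
  have hcoord (s : ℝ) (i : Fin 2) : buoyCurve γ t δ s i = γ s i + 1 / (3 * δ) *
      ∫ u in s..t s, ((γ u 0 - γ s 0) * deriv γ u 1 - (γ u 1 - γ s 1) * deriv γ u 0) *
        (γ u i - γ s i) := by
    have hint : IntervalIntegrable (fun u => det2 (γ u - γ s) (deriv γ u) • (γ u - γ s))
        volume s (t s) := Continuous.intervalIntegrable (by unfold det2; fun_prop) _ _
    have : (∫ u in s..t s, det2 (γ u - γ s) (deriv γ u) • (γ u - γ s)) i =
        ∫ u in s..t s, det2 (γ u - γ s) (deriv γ u) * (γ u i - γ s i) :=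
      ((EuclideanSpace.proj i : R2 →L[ℝ] ℝ).intervalIntegral_comp_comm hint).symm
    simp only [buoyCurve, PiLp.add_apply, PiLp.smul_apply, smul_eq_mul, this]
    rfl
  rw [hasDerivAt_iff_hasFDerivAt, ← hasFDerivWithinAt_univ, hasFDerivWithinAt_euclidean]
  intro i
  rw [hasFDerivWithinAt_univ]
  suffices h : HasDerivAt (fun s => buoyCurve γ t δ s i)
      (((-det2 (γ (t s) - γ s) (deriv γ s) / (6 * δ)) • (γ (t s) - γ s)) i) s by
    refine h.hasFDerivAt.congr_fderiv ?_
    ext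
    simp
  simp only [hcoord]
  fin_cases i
  · have hm := hasDerivAt_chord_moment (fun u => hasDerivAt_coord (hd u) 0)
      (fun u => hasDerivAt_coord (hd u) 1) (by fun_prop) (by fun_prop) (ht s).hasDerivAt
    refine ((hasDerivAt_coord (hd s) 0).add (hm.const_mul (1 / (3 * δ)))).congr_deriv ?_
    simp only [det2, PiLp.sub_apply, PiLp.smul_apply, smul_eq_mul, Fin.zero_eta]
    set I := ∫ u in s..t s, ((γ u 0 - γ s 0) * deriv γ u 1 - (γ u 1 - γ s 1) * deriv γ u 0)
    have hI : I = 2 * δ := by linarith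
    rw [hI]
    field_simp
    linear_combination 12 * (γ (t s) 0 - γ s 0) * htan
  · have hm := hasDerivAt_chord_moment (fun u => hasDerivAt_coord (hd u) 1)
      (fun u => hasDerivAt_coord (hd u) 0) (by fun_prop) (by fun_prop) (ht s).hasDerivAt
    have hswap (s : ℝ) : (∫ u in s..t s, ((γ u 0 - γ s 0) * deriv γ u 1 -
        (γ u 1 - γ s 1) * deriv γ u 0) * (γ u 1 - γ s 1)) =
        -∫ u in s..t s, ((γ u 1 - γ s 1) * deriv γ u 0 -
        (γ u 0 - γ s 0) * deriv γ u 1) * (γ u 1 - γ s 1) := by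
      rw [← intervalIntegral.integral_neg]
      congr 1
      funext u
      ring
    have hI : ∫ u in s..t s, ((γ u 1 - γ s 1) * deriv γ u 0 - (γ u 0 - γ s 0) * deriv γ u 1) =
        -(2 * δ) := by
      rw [← hAs, ← mul_assoc, mul_one_div_cancel two_ne_zero, one_mul,
        ← intervalIntegral.integral_neg]
      congr 1
      funext u
      ring
    rw [hI] at hm
    simp only [Fin.mk_one, hswap]
    refine ((hasDerivAt_coord (hd s) 1).add (hm.neg.const_mul (1 / (3 * δ)))).congr_deriv ?_
    simp only [det2, PiLp.sub_apply, PiLp.smul_apply, smul_eq_mul]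
    field_simp
    linear_combination 12 * (γ (t s) 1 - γ s 1) * htan

/-- The constant relating the affine arc length of the buoyancy curve to the chords of
flotation. -/
lemma affine_length_const {δ n : ℝ} (hδ : 0 < δ) (hn : 0 < n) :
    ((3/2) * δ) ^ ((2:ℝ)/3) * ((12 * δ / n ^ 3) ^ ((1:ℝ)/3) * n) = 3 * δ := by
  have h1 : ((3/2) * δ) ^ ((2:ℝ)/3) = (((3/2) * δ) ^ 2) ^ ((1:ℝ)/3) := by
    rw [← Real.rpow_natCast, ← Real.rpow_mul (by positivity)]
    norm_num
  have h2 {x : ℝ} (hx : 0 ≤ x) : (x ^ 3) ^ ((1:ℝ)/3) = x := by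
    rw [← Real.rpow_natCast, ← Real.rpow_mul hx]
    norm_num
  nth_rewrite 2 [← h2 hn.le]
  rw [h1, ← Real.mul_rpow (by positivity) (by positivity),
    ← Real.mul_rpow (by positivity) (by positivity), ← h2 (x := 3 * δ) (by positivity)]
  congr 1
  field_simp
  norm_num

/-- A periodic function has the same integral over a period after an equivariant change of
variables. -/
lemma integral_period_comp_mul_deriv {g t : ℝ → ℝ} {L : ℝ} (hg : Continuous g)
    (hper : Function.Periodic g L) (ht : ContDiff ℝ 1 t) (htL : t L = t 0 + L) :
    ∫ s in (0:ℝ)..L, g (t s) * deriv t s = ∫ s in (0:ℝ)..L, g s := by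
  have h := integral_comp_mul_deriv (a := 0) (b := L) (f := t) (f' := deriv t) (g := g)
    (fun s _ => (ht.differentiable (by simp) s).hasDerivAt)
    (ht.continuous_deriv (by simp)).continuousOn hg
  rw [htL, hper.intervalIntegral_add_eq (t 0) 0, zero_add] at h
  exact h


/-- the area of `K` minus the area enclosed by the flotation curve equals
one half of `đ^(2/3)` times the affine arc length of the buoyancy curve. -/
theorem stmt14
    (γ : ℝ → R2) (L : ℝ) (hL : 0 < L)
    (hγ : ContDiff ℝ 2 γ)
    (hper : ∀ s, γ (s + L) = γ s)
    (hreg : ∀ s, deriv γ s ≠ 0)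
    (hinj : Set.InjOn γ (Set.Ico 0 L))
    (hor : 0 < ∫ s in (0:ℝ)..L, det2 (γ s) (deriv γ s))
    (K : Set R2) (hKconv : Convex ℝ K) (hKcomp : IsCompact K)
    (hKint : (interior K).Nonempty) (hKbd : frontier K = Set.range γ)
    (δ : ℝ) (hδ0 : 0 < δ) (hδK : δ < (volume K).toReal)
    (t : ℝ → ℝ) (ht : ContDiff ℝ 1 t)
    (htrange : ∀ s, s < t s ∧ t s < s + L)
    (hA : ∀ s, (1/2) * ∫ u in s..t s, det2 (γ u - γ s) (deriv γ u) = δ)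
    (hc1 : ∀ s, det2 (γ (t s) - γ s) (deriv γ s) ≠ 0)
    (hc2 : ∀ s, det2 (γ (t s) - γ s) (deriv γ (t s)) ≠ 0) :
    (1/2) * (∫ s in (0:ℝ)..L, det2 (γ s) (deriv γ s)) -
        (1/2) * (∫ s in (0:ℝ)..L, det2 (flotCurve γ t s) (deriv (flotCurve γ t) s)) =
      (1/2) * ((3/2) * δ) ^ ((2:ℝ)/3) *
        ∫ s in (0:ℝ)..L,
          (12 * δ / ‖γ (t s) - γ s‖ ^ 3) ^ ((1:ℝ)/3) * ‖deriv (buoyCurve γ t δ) s‖ := by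
  have hγ1 : ContDiff ℝ 1 γ := hγ.of_le (by norm_num)
  have hd (u : ℝ) : HasDerivAt γ (deriv γ u) u := (hγ1.differentiable (by simp) u).hasDerivAt
  have htd : Differentiable ℝ t := ht.differentiable (by simp)
  have cγ : Continuous γ := hγ1.continuous
  have cγ' : Continuous (deriv γ) := hγ1.continuous_deriv (by simp)
  have ct : Continuous t := ht.continuous
  have ct' : Continuous (deriv t) := ht.continuous_deriv (by simp)
  have hγK (u : ℝ) : γ u ∈ K :=
    hKcomp.isClosed.frontier_subset (hKbd ▸ Set.mem_range_self u)
  have hnonneg (s u : ℝ) : 0 ≤ det2 (γ u - γ s) (deriv γ u) :=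
    det2_tangent_nonneg hKconv hKint hKbd hγK hL hγ1 hper hreg hor u (hγK s)
  have htL : t L = t 0 + L := by
    simpa using flotation_add_period hγ1 hper hA hc2 hnonneg 0
  have hperd (u : ℝ) : deriv γ (u + L) = deriv γ u := by
    rw [← deriv_comp_add_const, funext hper]
  have hchord (s : ℝ) : det2 (γ (t s) - γ s) (deriv γ s) ≤ 0 := by
    have := hnonneg (t s) s
    simp only [det2, PiLp.sub_apply] at this ⊢
    linarith
  have harea : ∫ s in (0:ℝ)..L, det2 (γ (t s)) (deriv γ (t s)) * deriv t s =
      ∫ s in (0:ℝ)..L, det2 (γ s) (deriv γ s) :=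
    integral_period_comp_mul_deriv (g := fun s => det2 (γ s) (deriv γ s))
      (by unfold det2; fun_prop) (fun s => by simp only [hper, hperd]) ht htL
  have hflot (s : ℝ) : det2 (flotCurve γ t s) (deriv (flotCurve γ t) s) =
      1 / 2 * (det2 (γ s) (deriv γ s) + det2 (γ (t s)) (deriv γ (t s)) * deriv t s +
        det2 (γ (t s) - γ s) (deriv γ s)) := by
    have h : HasDerivAt (flotCurve γ t)
        (((1:ℝ)/2) • (deriv γ s + deriv t s • deriv γ (t s))) s :=
      ((hd s).add ((hd (t s)).scomp s (htd s).hasDerivAt)).const_smul ((1:ℝ)/2)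
    have htan := det2_chord_deriv hγ1 htd hA s
    rw [h.deriv]
    simp only [flotCurve, det2, PiLp.sub_apply, PiLp.add_apply, PiLp.smul_apply, smul_eq_mul]
      at htan ⊢
    linear_combination (-1 / 4) * htan
  have hbuoy (s : ℝ) : ((3/2) * δ) ^ ((2:ℝ)/3) *
      ((12 * δ / ‖γ (t s) - γ s‖ ^ 3) ^ ((1:ℝ)/3) * ‖deriv (buoyCurve γ t δ) s‖) =
      -(1 / 2) * det2 (γ (t s) - γ s) (deriv γ s) := by
    have hn : 0 < ‖γ (t s) - γ s‖ := by
      refine norm_pos_iff.2 fun h => hc1 s ?_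
      simp [h, det2]
    rw [(hasDerivAt_buoyCurve hδ0.ne' hγ1 htd hA s).deriv, norm_smul, Real.norm_eq_abs,
      abs_of_nonneg (div_nonneg (neg_nonneg.2 (hchord s)) (by positivity))]
    have := affine_length_const hδ0 hn
    calc _ = (((3/2) * δ) ^ ((2:ℝ)/3) * ((12 * δ / ‖γ (t s) - γ s‖ ^ 3) ^ ((1:ℝ)/3) *
          ‖γ (t s) - γ s‖)) * (-det2 (γ (t s) - γ s) (deriv γ s) / (6 * δ)) := by ring
      _ = _ := by
        rw [this]
        field_simp
        ring
  have i1 : IntervalIntegrable (fun s => det2 (γ s) (deriv γ s)) volume 0 L :=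
    Continuous.intervalIntegrable (by unfold det2; fun_prop) _ _
  have i2 : IntervalIntegrable (fun s => det2 (γ (t s)) (deriv γ (t s)) * deriv t s) volume 0 L :=
    Continuous.intervalIntegrable (by unfold det2; fun_prop) _ _
  have i3 : IntervalIntegrable (fun s => det2 (γ (t s) - γ s) (deriv γ s)) volume 0 L :=
    Continuous.intervalIntegrable (by unfold det2; fun_prop) _ _
  rw [mul_assoc (1 / 2) (((3/2) * δ) ^ ((2:ℝ)/3)),
    ← intervalIntegral.integral_const_mul (((3/2) * δ) ^ ((2:ℝ)/3))]
  simp only [hflot, hbuoy, intervalIntegral.integral_const_mul]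
  rw [intervalIntegral.integral_add (i1.add i2) i3, intervalIntegral.integral_add i1 i2, harea]
  ring
end
end
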